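/- Let n ∈ ℕ, let q be a real number with 0 < q < 1, and let H = ℓ²(ℕⁿ × ℤ) with standard orthonormal basis {e_k : k = (k₀, …, kₙ) ∈ ℕⁿ × ℤ}. Let A₀, …, Aₙ be the bounded operators on H determined on basis vectors by: A₀ e_{(k₀, …, kₙ)} = √(1 − q^{2(k₀+1)}) e_{(k₀+1, k₁, …, kₙ)}; A_i e_{(k₀, …, kₙ)} = q^{k₀+⋯+k_{i−1}} √(1 − q^{2(k_i+1)}) e_{(k₀, …, k_i+1, …, kₙ)} for 0 < i < n; Aₙ e_{(k₀, …, kₙ)} = q^{k₀+⋯+k_{n−1}} e_{(k₀, …, k_{n−1}, kₙ+1)}. Let Z₀, …, Zₙ be the bounded operators on H determined on basis vectors by: Z₀ e_{(k₀, …, kₙ)} = e_{(k₀+1, k₁, …, kₙ)}; Z_i e_{(k₀, …, kₙ)} = δ_{k₀,0} ⋯ δ_{k_{i−1},0} e_{(0, …, 0, k_i+1, k_{i+1}, …, kₙ)} for 0 < i < n; Zₙ e_{(k₀, …, kₙ)} = δ_{k₀,0} ⋯ δ_{k_{n−1},0} e_{(0, …, 0, kₙ+1)}. Then the closure (in the operator-norm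 topology) of the unital *-subalgebra of B(H) generated by {A₀, …, Aₙ} equals the closure of the unital *-subalgebra of B(H) generated by {Z₀, …, Zₙ}. -/

import Mathlib

open Finset

/-- The Hilbert space `ℓ²(ℕⁿ × ℤ)`. -/
abbrev QSphereL2 (n : ℕ) : Type :=
  lp (fun _ : (Fin n → ℕ) × ℤ => ℂ) 2

/-- The standard basis vector `e k` of `ℓ²(ℕⁿ × ℤ)`. -/
noncomputable abbrev QSphereL2.e {n : ℕ} (k : (Fin n → ℕ) × ℤ) : QSphereL2 n :=
  lp.single 2 k (1 : ℂ)

section QSGen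

set_option linter.unusedSectionVars false

variable {K : Type} [DecidableEq K]

local notation "HH" => lp (fun _ : K => ℂ) 2

theorem qs_ext {S T : HH →L[ℂ] HH}
    (h : ∀ k, S (lp.single 2 k (1 : ℂ)) = T (lp.single 2 k (1 : ℂ))) : S = T := by
  refine lp.ext_continuousLinearMap (by simp) fun i => ?_
  apply ContinuousLinearMap.ext_ring
  exact h i

theorem qs_diag (f : K → ℂ) (C : ℝ) (hC : 0 ≤ C) (hf : ∀ k, ‖f k‖ ≤ C) :
    ∃ T : HH →L[ℂ] HH, ‖T‖ ≤ C ∧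
      ∀ k, T (lp.single 2 k (1 : ℂ)) = f k • lp.single 2 k (1 : ℂ) := by
  have hle : ∀ (x : HH) (k : K), ‖f k * x k‖ ≤ ‖((C : ℂ) • x) k‖ := by
    intro x k
    simp only [lp.coeFn_smul, Pi.smul_apply, smul_eq_mul, norm_mul]
    rw [Complex.norm_of_nonneg hC]
    gcongr
    exact hf k
  have hmem : ∀ x : HH, Memℓp (fun k => f k * x k) 2 := by
    intro x
    exact (lp.memℓp ((C : ℂ) • x)).mono' (hle x)
  let L : HH →ₗ[ℂ] HH :=
    { toFun := fun x => ⟨fun k => f k * x k, hmem x⟩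
      map_add' := by
        intro x y
        apply lp.ext
        funext k
        exact mul_add (f k) (x k) (y k)
      map_smul' := by
        intro c x
        apply lp.ext
        funext k
        exact mul_left_comm (f k) c (x k) }
  have hb : ∀ x, ‖L x‖ ≤ C * ‖x‖ := by
    intro x
    have := lp.norm_mono (p := 2) (x := L x) (y := (C : ℂ) • x) (by simp) (hle x)
    rwa [norm_smul, Complex.norm_of_nonneg hC] at this
  refine ⟨L.mkContinuous C hb, L.mkContinuous_norm_le hC hb, fun k => ?_⟩
  apply lp.ext
  funext l
  change f l * (lp.single 2 k (1 : ℂ) : HH) l = f k * (lp.single 2 k (1 : ℂ) : HH) l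
  by_cases h : l = k
  · subst h; rfl
  · rw [lp.single_apply_ne _ _ _ h]; simp

theorem qs_diag_norm (T : HH →L[ℂ] HH) (f : K → ℂ) (C : ℝ) (hC : 0 ≤ C) (hf : ∀ k, ‖f k‖ ≤ C)
    (hT : ∀ k, T (lp.single 2 k (1 : ℂ)) = f k • lp.single 2 k (1 : ℂ)) : ‖T‖ ≤ C := by
  obtain ⟨S, hS, hS'⟩ := qs_diag f C hC hf
  rwa [qs_ext (S := T) (T := S) fun k => by rw [hT, hS']]

theorem qs_star_coord (T : HH →L[ℂ] HH) (f : K → ℂ) (σ : K → K)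
    (hT : ∀ k, T (lp.single 2 k (1 : ℂ)) = f k • lp.single 2 (σ k) (1 : ℂ)) (l k : K) :
    (star T (lp.single 2 l (1 : ℂ))) k =
      star (f k) * (lp.single 2 l (1 : ℂ) : HH) (σ k) := by
  have h1 := lp.inner_single_left (𝕜 := ℂ) k (1 : ℂ) (star T (lp.single 2 l (1 : ℂ)))
  rw [ContinuousLinearMap.star_eq_adjoint, ContinuousLinearMap.adjoint_inner_right, hT,
    inner_smul_left, lp.inner_single_left] at h1
  simp only [RCLike.inner_apply, map_one, mul_one] at h1
  rw [ContinuousLinearMap.star_eq_adjoint, ← h1]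
  rfl

theorem qs_star_range (T : HH →L[ℂ] HH) (f : K → ℂ) (σ : K → K) (hσ : Function.Injective σ)
    (hT : ∀ k, T (lp.single 2 k (1 : ℂ)) = f k • lp.single 2 (σ k) (1 : ℂ)) (k : K) :
    star T (lp.single 2 (σ k) (1 : ℂ)) = star (f k) • lp.single 2 k (1 : ℂ) := by
  apply lp.ext
  funext l
  rw [qs_star_coord T f σ hT]
  change _ = star (f k) * (lp.single 2 k (1 : ℂ) : HH) l
  by_cases h : l = k
  · subst h; simp
  · rw [lp.single_apply_ne _ _ _ h, lp.single_apply_ne _ _ _ (fun h' => h (hσ h'))]; simp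

theorem qs_star_notrange (T : HH →L[ℂ] HH) (f : K → ℂ) (σ : K → K)
    (hT : ∀ k, T (lp.single 2 k (1 : ℂ)) = f k • lp.single 2 (σ k) (1 : ℂ)) (l : K)
    (hl : ∀ k, σ k ≠ l) :
    star T (lp.single 2 l (1 : ℂ)) = 0 := by
  apply lp.ext
  funext k
  rw [qs_star_coord T f σ hT, lp.single_apply_ne _ _ _ (hl k)]
  simp

/-- Fixed points of contractions lie in closed subalgebras. -/
theorem qs_fix (C : StarSubalgebra ℂ (HH →L[ℂ] HH)) (hC : IsClosed (C : Set (HH →L[ℂ] HH)))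
    (W X B : HH →L[ℂ] HH) (r : ℝ) (hr0 : 0 ≤ r) (hr1 : r < 1) (hW : W ∈ C) (hB : B ∈ C)
    (hW1 : ‖W‖ ≤ 1) (hX : X = B + (r : ℂ) • (W * X * star W)) : X ∈ C := by
  have key : ∀ m : ℕ, ∃ Y ∈ C, ‖X - Y‖ ≤ r ^ m * ‖X‖ := by
    intro m
    induction m with
    | zero => exact ⟨0, C.zero_mem, by simp⟩
    | succ m ih =>
      obtain ⟨Y, hY, hYn⟩ := ih
      refine ⟨B + (r : ℂ) • (W * Y * star W),
        C.add_mem hB (C.smul_mem (mul_mem (mul_mem hW hY) (star_mem hW)) _), ?_⟩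
      have : X - (B + (r : ℂ) • (W * Y * star W)) = (r : ℂ) • (W * (X - Y) * star W) := by
        conv_lhs => rw [hX]
        rw [mul_sub, sub_mul, smul_sub]
        abel
      rw [this, norm_smul, Complex.norm_of_nonneg hr0]
      have h1 : ‖W * (X - Y) * star W‖ ≤ ‖X - Y‖ := by
        calc ‖W * (X - Y) * star W‖ ≤ ‖W‖ * ‖X - Y‖ * ‖star W‖ :=
              (norm_mul_le _ _).trans (by gcongr; exact norm_mul_le _ _)
          _ ≤ 1 * ‖X - Y‖ * 1 := by
              gcongr
              rw [ContinuousLinearMap.star_eq_adjoint, LinearIsometryEquiv.norm_map]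
              exact hW1
          _ = _ := by ring
      calc r * ‖W * (X - Y) * star W‖ ≤ r * (r ^ m * ‖X‖) := by
            gcongr
            exact h1.trans hYn
        _ = _ := by ring
  choose Y hY hYn using key
  refine hC.mem_of_tendsto (f := Y) (b := Filter.atTop) ?_ (Filter.Eventually.of_forall hY)
  rw [tendsto_iff_norm_sub_tendsto_zero]
  refine squeeze_zero (fun _ => norm_nonneg _) (fun m => ?_)
    (by simpa using (tendsto_pow_atTop_nhds_zero_of_lt_one hr0 hr1).mul_const ‖X‖)
  rw [norm_sub_rev]
  exact hYn m

theorem qs_rec (C : StarSubalgebra ℂ (HH →L[ℂ] HH)) (hC : IsClosed (C : Set (HH →L[ℂ] HH)))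
    (W X B : HH →L[ℂ] HH) (r : ℝ) (hr0 : 0 ≤ r) (hr1 : r < 1) (hW : W ∈ C) (hB : B ∈ C)
    (w x b : K → ℂ) (σ τ : K → K) (hσ : Function.Injective σ)
    (hw1 : ∀ k, ‖w k‖ ≤ 1)
    (hWe : ∀ k, W (lp.single 2 k (1 : ℂ)) = w k • lp.single 2 (σ k) (1 : ℂ))
    (hXe : ∀ k, X (lp.single 2 k (1 : ℂ)) = x k • lp.single 2 (τ k) (1 : ℂ))
    (hBe : ∀ k, B (lp.single 2 k (1 : ℂ)) = b k • lp.single 2 (τ k) (1 : ℂ))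
    (hcomm : ∀ k, σ (τ k) = τ (σ k))
    (h0 : ∀ l, (∀ k, σ k ≠ l) → x l = b l)
    (h1 : ∀ k, x (σ k) = b (σ k) + r * (star (w k) * x k * w (τ k))) : X ∈ C := by
  refine qs_fix C hC W X B r hr0 hr1 hW hB ?_ ?_
  · have h2 : ‖star W * W‖ ≤ 1 := by
      refine qs_diag_norm _ (fun k => w k * star (w k)) 1 zero_le_one (fun k => ?_) fun k => ?_
      · rw [norm_mul, norm_star]
        exact mul_le_one₀ (hw1 k) (norm_nonneg _) (hw1 k)
      · rw [mul_apply_eq_comp, hWe, map_smul, qs_star_range W w σ hσ hWe, smul_smul]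
    rw [ContinuousLinearMap.star_eq_adjoint] at h2
    have h3 := ContinuousLinearMap.norm_adjoint_comp_self W
    have h4 : ‖W‖ * ‖W‖ ≤ 1 := h3 ▸ h2
    nlinarith [norm_nonneg W]
  · refine qs_ext fun l => ?_
    rw [_root_.add_apply, _root_.smul_apply,
      mul_apply_eq_comp, mul_apply_eq_comp, hXe, hBe]
    by_cases hl : ∃ k, σ k = l
    · obtain ⟨k, rfl⟩ := hl
      rw [qs_star_range W w σ hσ hWe, map_smul, map_smul, hXe, map_smul, hWe, h1, hcomm,
        smul_smul, smul_smul, smul_smul, ← add_smul]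
      congr 1
      ring
    · push Not at hl
      rw [qs_star_notrange W w σ hWe l hl, h0 l hl]
      simp

theorem qs_poly (C : StarSubalgebra ℂ (HH →L[ℂ] HH)) (T : HH →L[ℂ] HH) (hT : T ∈ C) (f : K → ℝ)
    (hTe : ∀ k, T (lp.single 2 k (1 : ℂ)) = (f k : ℂ) • lp.single 2 k (1 : ℂ))
    (p : Polynomial ℝ) :
    ∃ S ∈ C, ∀ k, S (lp.single 2 k (1 : ℂ)) =
      ((p.eval (f k) : ℝ) : ℂ) • lp.single 2 k (1 : ℂ) := by
  induction p using Polynomial.induction_on with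
  | C a =>
    refine ⟨(a : ℂ) • 1, C.smul_mem C.one_mem _, fun k => ?_⟩
    rw [Polynomial.eval_C]
    rfl
  | add p r hp hr =>
    obtain ⟨S, hS, hSe⟩ := hp
    obtain ⟨R, hR, hRe⟩ := hr
    refine ⟨S + R, C.add_mem hS hR, fun k => ?_⟩
    rw [_root_.add_apply, hSe, hRe, ← add_smul]
    simp
  | monomial m a hp =>
    obtain ⟨S, hS, hSe⟩ := hp
    refine ⟨S * T, C.mul_mem hS hT, fun k => ?_⟩
    rw [mul_apply_eq_comp, hTe, map_smul, hSe, smul_smul]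
    congr 1
    simp only [Polynomial.eval_mul, Polynomial.eval_pow, Polynomial.eval_X, Polynomial.eval_C]
    push_cast
    ring

theorem qs_fc (C : StarSubalgebra ℂ (HH →L[ℂ] HH)) (hC : IsClosed (C : Set (HH →L[ℂ] HH)))
    (T S : HH →L[ℂ] HH) (hT : T ∈ C) (f : K → ℝ) (hf : ∀ k, f k ∈ Set.Icc (0 : ℝ) 1)
    (hTe : ∀ k, T (lp.single 2 k (1 : ℂ)) = (f k : ℂ) • lp.single 2 k (1 : ℂ))
    (g : ℝ → ℝ) (hg : ContinuousOn g (Set.Icc 0 1))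
    (hSe : ∀ k, S (lp.single 2 k (1 : ℂ)) = ((g (f k) : ℝ) : ℂ) • lp.single 2 k (1 : ℂ)) :
    S ∈ C := by
  have : S ∈ closure (C : Set (HH →L[ℂ] HH)) := by
    rw [Metric.mem_closure_iff]
    intro ε hε
    obtain ⟨p, hp⟩ := exists_polynomial_near_of_continuousOn 0 1 g hg (ε / 2) (by positivity)
    obtain ⟨R, hR, hRe⟩ := qs_poly C T hT f hTe p
    refine ⟨R, hR, ?_⟩
    rw [dist_comm, dist_eq_norm]
    refine lt_of_le_of_lt (qs_diag_norm (R - S) (fun k => ((p.eval (f k) - g (f k) : ℝ) : ℂ))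
      (ε / 2) (by positivity) (fun k => ?_) (fun k => ?_)) (by linarith)
    · rw [Complex.norm_real, Real.norm_eq_abs]
      exact (hp _ (hf k)).le
    · rw [_root_.sub_apply, hSe, hRe, ← sub_smul]
      push_cast
      rfl
  rwa [hC.closure_eq] at this

theorem qs_fc' (C : StarSubalgebra ℂ (HH →L[ℂ] HH)) (hC : IsClosed (C : Set (HH →L[ℂ] HH)))
    (T : HH →L[ℂ] HH) (hT : T ∈ C) (f : K → ℝ) (hf : ∀ k, f k ∈ Set.Icc (0 : ℝ) 1)
    (hTe : ∀ k, T (lp.single 2 k (1 : ℂ)) = (f k : ℂ) • lp.single 2 k (1 : ℂ))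
    (g : ℝ → ℝ) (hg : ContinuousOn g (Set.Icc 0 1)) :
    ∃ S ∈ C, ∀ k, S (lp.single 2 k (1 : ℂ)) = ((g (f k) : ℝ) : ℂ) • lp.single 2 k (1 : ℂ) := by
  obtain ⟨M, hM⟩ := isCompact_Icc.exists_bound_of_continuousOn hg
  obtain ⟨S, -, hS⟩ := qs_diag (fun k => ((g (f k) : ℝ) : ℂ)) (max M 0) (le_max_right _ _)
    (fun k => by
      rw [Complex.norm_real]
      exact (hM _ (hf k)).trans (le_max_left _ _))
  exact ⟨S, qs_fc C hC T S hT f hf hTe g hg hS, hS⟩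

end QSGen

section QSSpec

variable {n : ℕ}

def qsP (j : ℕ) (k : (Fin n → ℕ) × ℤ) : Prop := ∀ m : Fin n, (m : ℕ) < j → k.1 m = 0

open Classical in
noncomputable def qsw (j : ℕ) (k : (Fin n → ℕ) × ℤ) : ℝ := if qsP j k then 1 else 0

def qsσ (i : Fin n) (k : (Fin n → ℕ) × ℤ) : (Fin n → ℕ) × ℤ :=
  (Function.update k.1 i (k.1 i + 1), k.2)

def qsτ (k : (Fin n → ℕ) × ℤ) : (Fin n → ℕ) × ℤ := (k.1, k.2 + 1)

def qss (j : ℕ) (k : (Fin n → ℕ) × ℤ) : ℕ := ∑ m : Fin n, if (m : ℕ) < j then k.1 m else 0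

theorem qsw_pos {j : ℕ} {k : (Fin n → ℕ) × ℤ} (h : qsP j k) : qsw j k = 1 := by
  simp [qsw, h]

theorem qsw_neg {j : ℕ} {k : (Fin n → ℕ) × ℤ} (h : ¬ qsP j k) : qsw j k = 0 := by
  simp [qsw, h]

theorem qsw_norm (j : ℕ) (k : (Fin n → ℕ) × ℤ) : ‖((qsw j k : ℝ) : ℂ)‖ ≤ 1 := by
  by_cases h : qsP j k
  · simp [qsw_pos h]
  · simp [qsw_neg h]

theorem qsw_congr {j : ℕ} {k l : (Fin n → ℕ) × ℤ} (h : qsP j k ↔ qsP j l) :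
    qsw j k = qsw j l := by
  by_cases hl : qsP j l
  · rw [qsw_pos hl, qsw_pos (h.2 hl)]
  · rw [qsw_neg hl, qsw_neg (fun h' => hl (h.1 h'))]

theorem qsσ_inj (i : Fin n) : Function.Injective (qsσ i) := by
  rintro ⟨k, a⟩ ⟨l, b⟩ h
  simp only [qsσ, Prod.mk.injEq] at h
  obtain ⟨h1, rfl⟩ := h
  simp only [Prod.mk.injEq, and_true]
  funext m
  have := congrFun h1 m
  by_cases hm : m = i
  · subst hm; simpa using this
  · simpa [hm] using this

theorem qsσ_self (i : Fin n) (k : (Fin n → ℕ) × ℤ) : (qsσ i k).1 i = k.1 i + 1 := by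
  simp [qsσ]

theorem qsσ_ne {i m : Fin n} (h : m ≠ i) (k : (Fin n → ℕ) × ℤ) : (qsσ i k).1 m = k.1 m := by
  simp [qsσ, h]

theorem qsσ_range (i : Fin n) (l : (Fin n → ℕ) × ℤ) (h : l.1 i ≠ 0) : ∃ k, qsσ i k = l := by
  refine ⟨(Function.update l.1 i (l.1 i - 1), l.2), ?_⟩
  simp only [qsσ, Function.update_self, Function.update_idem]
  rw [Nat.sub_add_cancel (Nat.pos_of_ne_zero h), Function.update_eq_self]

theorem qsP_succ (i : Fin n) (k : (Fin n → ℕ) × ℤ) :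
    qsP (i + 1) k ↔ qsP i k ∧ k.1 i = 0 := by
  constructor
  · intro h
    exact ⟨fun m hm => h m (by omega), h i (by omega)⟩
  · rintro ⟨h, h'⟩ m hm
    by_cases hmi : m = i
    · rwa [hmi]
    · exact h m (by have : (m : ℕ) ≠ i := fun h => hmi (Fin.ext h)
                    omega)

theorem qsP_σ (j : ℕ) (i : Fin n) (h : j ≤ i) (k : (Fin n → ℕ) × ℤ) :
    qsP j (qsσ i k) ↔ qsP j k := by
  refine forall₂_congr fun m hm => ?_
  rw [qsσ_ne]
  rintro rfl
  omega

theorem qsw_succ_σ (i : Fin n) (k : (Fin n → ℕ) × ℤ) : qsw (i + 1) (qsσ i k) = 0 := by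
  apply qsw_neg
  rw [qsP_succ, qsσ_self]
  simp

theorem qsw_succ_zero (i : Fin n) (k : (Fin n → ℕ) × ℤ) (h : k.1 i = 0) :
    qsw (i + 1) k = qsw i k := by
  by_cases hl : qsP i k
  · rw [qsw_pos hl, qsw_pos ((qsP_succ i k).2 ⟨hl, h⟩)]
  · rw [qsw_neg hl, qsw_neg (fun h' => hl ((qsP_succ i k).1 h').1)]

theorem qss_succ (i : Fin n) (k : (Fin n → ℕ) × ℤ) : qss (i + 1) k = qss i k + k.1 i := by
  have : k.1 i = ∑ m : Fin n, if m = i then k.1 m else 0 := by simp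
  rw [qss, qss, this, ← Finset.sum_add_distrib]
  refine Finset.sum_congr rfl fun m _ => ?_
  rcases lt_trichotomy (m : ℕ) i with h | h | h
  · have : m ≠ i := by rintro rfl; omega
    simp [h, this, Nat.lt_succ_of_lt h]
  · have : m = i := Fin.ext h
    simp [this]
  · have : m ≠ i := by rintro rfl; omega
    have h2 : ¬ ((m : ℕ) < i) := by omega
    have h3 : ¬ ((m : ℕ) < i + 1) := by omega
    simp [this, h2, h3]

theorem qss_σ_ge (j : ℕ) (i : Fin n) (h : j ≤ i) (k : (Fin n → ℕ) × ℤ) :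
    qss j (qsσ i k) = qss j k := by
  refine Finset.sum_congr rfl fun m _ => ?_
  split_ifs with hm
  · rw [qsσ_ne]
    rintro rfl
    omega
  · rfl

theorem qss_σ_lt (j : ℕ) (i : Fin n) (h : (i : ℕ) < j) (k : (Fin n → ℕ) × ℤ) :
    qss j (qsσ i k) = qss j k + 1 := by
  have : 1 = ∑ m : Fin n, if m = i then 1 else 0 := by simp
  rw [qss, qss, this, ← Finset.sum_add_distrib]
  refine Finset.sum_congr rfl fun m _ => ?_
  by_cases hm : m = i
  · subst hm; simp [h, qsσ_self]
  · rw [qsσ_ne hm]; simp [hm]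

theorem qss_zero_iff (j : ℕ) (k : (Fin n → ℕ) × ℤ) : qss j k = 0 ↔ qsP j k := by
  simp [qss, qsP]

theorem qss_Iio (i : Fin n) (k : (Fin n → ℕ) × ℤ) :
    ∑ m ∈ Finset.Iio i, k.1 m = qss i k := by
  rw [qss, ← Finset.sum_filter]
  refine Finset.sum_congr ?_ fun _ _ => rfl
  ext m
  simp

theorem qss_last (k : (Fin n → ℕ) × ℤ) : ∑ m, k.1 m = qss n k := by
  simp [qss]

theorem qsP_Iio (i : Fin n) (k : (Fin n → ℕ) × ℤ) :
    (∀ m ∈ Finset.Iio i, k.1 m = 0) ↔ qsP i k := by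
  simp [qsP]

theorem qsP_last (k : (Fin n → ℕ) × ℤ) : (∀ m, k.1 m = 0) ↔ qsP n k := by
  simp [qsP]

theorem qs_TT (i : Fin n) (T : QSphereL2 n →L[ℂ] QSphereL2 n) (f d : (Fin n → ℕ) × ℤ → ℝ)
    (hT : ∀ k, T (QSphereL2.e k) = (f k : ℂ) • QSphereL2.e (qsσ i k))
    (h0 : ∀ k, k.1 i = 0 → d k = 0) (h1 : ∀ k, d (qsσ i k) = f k * f k) (l : (Fin n → ℕ) × ℤ) :
    (T * star T) (QSphereL2.e l) = (d l : ℂ) • QSphereL2.e l := by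
  rw [mul_apply_eq_comp]
  by_cases hl : l.1 i = 0
  · rw [qs_star_notrange T (fun k => (f k : ℂ)) (qsσ i) hT l, h0 l hl]
    · simp
    · rintro k rfl
      rw [qsσ_self] at hl
      omega
  · obtain ⟨k, rfl⟩ := qsσ_range i l hl
    rw [qs_star_range T (fun k => (f k : ℂ)) (qsσ i) (qsσ_inj i) hT, map_smul, hT, h1, smul_smul]
    simp

theorem qs_Z_Q (C : StarSubalgebra ℂ (QSphereL2 n →L[ℂ] QSphereL2 n))
    (Z : Fin n → (QSphereL2 n →L[ℂ] QSphereL2 n)) (hZC : ∀ i, Z i ∈ C)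
    (hZ : ∀ i k, Z i (QSphereL2.e k) = ((qsw i k : ℝ) : ℂ) • QSphereL2.e (qsσ i k)) :
    ∀ j : ℕ, j ≤ n → ∃ Q ∈ C, ∀ k, Q (QSphereL2.e k) = ((qsw j k : ℝ) : ℂ) • QSphereL2.e k := by
  intro j
  induction j with
  | zero =>
    intro _
    refine ⟨1, C.one_mem, fun k => ?_⟩
    rw [qsw_pos (by intro m hm; omega)]
    simp
  | succ j ih =>
    intro hj
    obtain ⟨Q, hQ, hQe⟩ := ih (by omega)
    let i : Fin n := ⟨j, hj⟩
    refine ⟨Q - Z i * star (Z i), sub_mem hQ (mul_mem (hZC i) (star_mem (hZC i))), fun k => ?_⟩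
    rw [_root_.sub_apply, hQe, qs_TT i (Z i) (qsw i) (fun k => qsw i k - qsw (i + 1) k) (hZ i),
      ← sub_smul]
    · simp [i]
    · intro k hk
      simp [qsw_succ_zero i k hk]
    · intro k
      simp only [qsw_succ_σ, sub_zero, qsw_congr (qsP_σ i i le_rfl k)]
      by_cases h : qsP i k
      · simp [qsw_pos h]
      · simp [qsw_neg h]

theorem qs_Z_E (C : StarSubalgebra ℂ (QSphereL2 n →L[ℂ] QSphereL2 n))
    (hC : IsClosed (C : Set (QSphereL2 n →L[ℂ] QSphereL2 n)))
    (q : ℝ) (hq0 : 0 < q) (hq1 : q < 1)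
    (Z : Fin n → (QSphereL2 n →L[ℂ] QSphereL2 n)) (hZC : ∀ i, Z i ∈ C)
    (hZ : ∀ i k, Z i (QSphereL2.e k) = ((qsw i k : ℝ) : ℂ) • QSphereL2.e (qsσ i k))
    (i : Fin n) :
    ∃ E ∈ C, ∀ k, E (QSphereL2.e k) =
      ((qsw i k * q ^ (2 * k.1 i) : ℝ) : ℂ) • QSphereL2.e k := by
  obtain ⟨Q, hQ, hQe⟩ := qs_Z_Q C Z hZC hZ (i + 1) i.2
  obtain ⟨E, -, hE⟩ := qs_diag (fun k : (Fin n → ℕ) × ℤ => ((qsw i k * q ^ (2 * k.1 i) : ℝ) : ℂ))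
    1 zero_le_one (fun k => by
      rw [Complex.ofReal_mul, norm_mul]
      refine mul_le_one₀ (qsw_norm _ _) (norm_nonneg _) ?_
      rw [Complex.norm_real, Real.norm_of_nonneg (by positivity)]
      exact pow_le_one₀ hq0.le hq1.le)
  refine ⟨E, ?_, hE⟩
  refine qs_rec C hC (Z i) E Q (q ^ 2) (by positivity) (pow_lt_one₀ hq0.le hq1 (by simp)) (hZC i) hQ
    (fun k => ((qsw i k : ℝ) : ℂ)) _ _ (qsσ i) id (qsσ_inj i) (qsw_norm i) (hZ i) hE hQe
    (fun k => rfl) ?_ ?_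
  · intro l hl
    have : l.1 i = 0 := by
      by_contra h
      obtain ⟨k, hk⟩ := qsσ_range i l h
      exact hl k hk
    simp only [qsw_succ_zero i l this, this]
    simp
  · intro k
    simp only [qsw_succ_σ, qsw_congr (qsP_σ i i le_rfl k), qsσ_self, id]
    by_cases h : qsP i k
    · simp [qsw_pos h]; ring
    · simp [qsw_neg h]

theorem qs_descent (C : StarSubalgebra ℂ (QSphereL2 n →L[ℂ] QSphereL2 n))
    (hC : IsClosed (C : Set (QSphereL2 n →L[ℂ] QSphereL2 n)))
    (q : ℝ) (hq0 : 0 < q) (hq1 : q < 1)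
    (Z : Fin n → (QSphereL2 n →L[ℂ] QSphereL2 n)) (hZC : ∀ i, Z i ∈ C)
    (hZ : ∀ i k, Z i (QSphereL2.e k) = ((qsw i k : ℝ) : ℂ) • QSphereL2.e (qsσ i k))
    (i : ℕ) (hi : i ≤ n) (A B : QSphereL2 n →L[ℂ] QSphereL2 n) (c : (Fin n → ℕ) × ℤ → ℝ)
    (τ : (Fin n → ℕ) × ℤ → (Fin n → ℕ) × ℤ)
    (hA : ∀ k, A (QSphereL2.e k) = (c k : ℂ) • QSphereL2.e (τ k))
    (hτ : ∀ k (m : Fin n), (m : ℕ) < i → (τ k).1 m = k.1 m)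
    (hτσ : ∀ k (m : Fin n), (m : ℕ) < i → qsσ m (τ k) = τ (qsσ m k))
    (hc : ∀ k (m : Fin n), (m : ℕ) < i → c (qsσ m k) = q * c k)
    (hBC : B ∈ C)
    (hB : ∀ k, B (QSphereL2.e k) = ((qsw i k * c k : ℝ) : ℂ) • QSphereL2.e (τ k)) : A ∈ C := by
  have hwτ : ∀ j ≤ i, ∀ k, qsw j (τ k) = qsw j k := fun j hj k => qsw_congr <|
    forall₂_congr fun m hm => by rw [hτ k m (by omega)]
  have key : ∀ d j : ℕ, j + d = i → ∀ X : QSphereL2 n →L[ℂ] QSphereL2 n,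
      (∀ k, X (QSphereL2.e k) = ((qsw j k * c k : ℝ) : ℂ) • QSphereL2.e (τ k)) → X ∈ C := by
    intro d
    induction d with
    | zero =>
      intro j hj X hX
      have hj : j = i := by omega
      subst hj
      rwa [qs_ext (S := X) (T := B) fun k => by rw [hX, hB]]
    | succ d ih =>
      intro j hj X hX
      obtain ⟨Q, hQ, hQe⟩ := qs_Z_Q C Z hZC hZ (j + 1) (by omega)
      let m : Fin n := ⟨j, by omega⟩
      have hmi : (m : ℕ) < i := by change j < i; omega
      have hQA : ∀ k, (Q * A) (QSphereL2.e k) =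
          ((qsw (j + 1) k * c k : ℝ) : ℂ) • QSphereL2.e (τ k) := by
        intro k
        rw [mul_apply_eq_comp, hA, map_smul, hQe, hwτ (j + 1) (by omega), smul_smul]
        congr 1
        push_cast
        ring
      have hQAC := ih (j + 1) (by omega) (Q * A) hQA
      refine qs_rec C hC (Z m) X (Q * A) q hq0.le hq1 (hZC m) hQAC
        (fun k => ((qsw m k : ℝ) : ℂ)) _ _ (qsσ m) τ (qsσ_inj m) (qsw_norm m) (hZ m) hX hQA
        (fun k => hτσ k m hmi) ?_ ?_
      · intro l hl
        have : l.1 m = 0 := by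
          by_contra h
          obtain ⟨k, hk⟩ := qsσ_range m l h
          exact hl k hk
        rw [← qsw_succ_zero m l this]
      · intro k
        have e1 : qsw (j + 1) (qsσ m k) = 0 := qsw_succ_σ m k
        have e2 : qsw j (qsσ m k) = qsw j k := qsw_congr (qsP_σ j m le_rfl k)
        have e3 : qsw (m : ℕ) k = qsw j k := rfl
        have e4 : qsw (m : ℕ) (τ k) = qsw j k := hwτ j (by omega) k
        simp only [e1, e2, e3, e4, hc k m hmi]
        by_cases h : qsP j k
        · simp [qsw_pos h]
        · simp [qsw_neg h]
  refine key i 0 (by omega) A fun k => ?_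
  rw [hA, qsw_pos (by intro m hm; omega), one_mul]

theorem qs_A_D (C : StarSubalgebra ℂ (QSphereL2 n →L[ℂ] QSphereL2 n))
    (q : ℝ) (hq0 : 0 < q) (hq1 : q < 1)
    (A : Fin n → (QSphereL2 n →L[ℂ] QSphereL2 n)) (hAC : ∀ i, A i ∈ C)
    (hA : ∀ i k, A i (QSphereL2.e k) =
      ((q ^ qss i k * √(1 - q ^ (2 * (k.1 i + 1))) : ℝ) : ℂ) • QSphereL2.e (qsσ i k)) :
    ∀ j : ℕ, j ≤ n → ∃ D ∈ C, ∀ k,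
      D (QSphereL2.e k) = ((q ^ (2 * qss j k) : ℝ) : ℂ) • QSphereL2.e k := by
  intro j
  induction j with
  | zero =>
    intro _
    refine ⟨1, C.one_mem, fun k => ?_⟩
    rw [(qss_zero_iff 0 k).2 (by intro m hm; omega)]
    simp
  | succ j ih =>
    intro hj
    obtain ⟨Q, hQ, hQe⟩ := ih (by omega)
    let i : Fin n := ⟨j, hj⟩
    refine ⟨Q - A i * star (A i), sub_mem hQ (mul_mem (hAC i) (star_mem (hAC i))), fun k => ?_⟩
    rw [_root_.sub_apply, hQe, qs_TT i (A i) _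
      (fun k => q ^ (2 * qss i k) - q ^ (2 * qss (i + 1) k)) (hA i), ← sub_smul]
    · simp [i]
    · intro k hk
      simp [qss_succ, hk]
    · intro k
      have hle : q ^ (2 * (k.1 i + 1)) ≤ 1 := pow_le_one₀ hq0.le hq1.le
      have hs := Real.mul_self_sqrt (sub_nonneg.2 hle)
      simp only [qss_succ, qss_σ_ge i i le_rfl, qsσ_self]
      rw [mul_mul_mul_comm, hs]
      ring

theorem qs_A_Q (C : StarSubalgebra ℂ (QSphereL2 n →L[ℂ] QSphereL2 n))
    (hC : IsClosed (C : Set (QSphereL2 n →L[ℂ] QSphereL2 n)))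
    (q : ℝ) (hq0 : 0 < q) (hq1 : q < 1)
    (A : Fin n → (QSphereL2 n →L[ℂ] QSphereL2 n)) (hAC : ∀ i, A i ∈ C)
    (hA : ∀ i k, A i (QSphereL2.e k) =
      ((q ^ qss i k * √(1 - q ^ (2 * (k.1 i + 1))) : ℝ) : ℂ) • QSphereL2.e (qsσ i k))
    (j : ℕ) (hj : j ≤ n) : ∃ Q ∈ C, ∀ k,
      Q (QSphereL2.e k) = ((qsw j k : ℝ) : ℂ) • QSphereL2.e k := by
  obtain ⟨D, hD, hDe⟩ := qs_A_D C q hq0 hq1 A hAC hA j hj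
  obtain ⟨S, hS, hSe⟩ := qs_fc' C hC D hD (fun k => q ^ (2 * qss j k))
    (fun k => ⟨by positivity, pow_le_one₀ hq0.le hq1.le⟩) hDe
    (fun x => max 0 ((x - q ^ 2) / (1 - q ^ 2))) (by fun_prop)
  refine ⟨S, hS, fun k => ?_⟩
  rw [hSe]
  have hq2 : q ^ 2 < 1 := pow_lt_one₀ hq0.le hq1 (by simp)
  congr 2
  by_cases h : qsP j k
  · rw [qsw_pos h, (qss_zero_iff j k).2 h]
    simp [div_self (sub_pos.2 hq2).ne']
  · rw [qsw_neg h]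
    rw [← qss_zero_iff] at h
    refine max_eq_left (div_nonpos_of_nonpos_of_nonneg ?_ (sub_pos.2 hq2).le)
    rw [sub_nonpos]
    exact pow_le_pow_of_le_one hq0.le hq1.le (by omega)

end QSSpec

/-- Let `0 < q < 1`, and let `A 0, …, A n` (resp. `Z 0, …, Z n`) be the
bounded operators on `ℓ²(ℕⁿ × ℤ)` representing the coordinate generators of the quantum
sphere `C(S^{2n+1}_q)` (resp. `C(S^{2n+1}_0)`). Then the norm closure of the unital
*-subalgebra of `B(ℓ²(ℕⁿ × ℤ))` generated by the `A i` equals the norm closure of the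
unital *-subalgebra generated by the `Z i`. -/
theorem qSphere_CStarAlgebra_independent_of_q
    (n : ℕ) (q : ℝ) (hq0 : 0 < q) (hq1 : q < 1)
    (A : Fin (n + 1) → (QSphereL2 n →L[ℂ] QSphereL2 n))
    (Z : Fin (n + 1) → (QSphereL2 n →L[ℂ] QSphereL2 n))
    (hA : ∀ (i : Fin n) (k : (Fin n → ℕ) × ℤ),
      A i.castSucc (QSphereL2.e k) =
        (((q ^ (∑ m ∈ Finset.Iio i, k.1 m) *
            Real.sqrt (1 - q ^ (2 * (k.1 i + 1))) : ℝ)) : ℂ) •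
          QSphereL2.e (Function.update k.1 i (k.1 i + 1), k.2))
    (hA_last : ∀ k : (Fin n → ℕ) × ℤ,
      A (Fin.last n) (QSphereL2.e k) =
        ((q ^ (∑ m : Fin n, k.1 m) : ℝ) : ℂ) • QSphereL2.e (k.1, k.2 + 1))
    (hZ : ∀ (i : Fin n) (k : (Fin n → ℕ) × ℤ),
      Z i.castSucc (QSphereL2.e k) =
        if ∀ m ∈ Finset.Iio i, k.1 m = 0 then
          QSphereL2.e (Function.update k.1 i (k.1 i + 1), k.2)
        else 0)
    (hZ_last : ∀ k : (Fin n → ℕ) × ℤ,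
      Z (Fin.last n) (QSphereL2.e k) =
        if ∀ m : Fin n, k.1 m = 0 then QSphereL2.e (k.1, k.2 + 1) else 0) :
    (StarAlgebra.adjoin ℂ (Set.range A)).topologicalClosure =
      (StarAlgebra.adjoin ℂ (Set.range Z)).topologicalClosure := by
  classical
  have hq2 : q ^ 2 < 1 := pow_lt_one₀ hq0.le hq1 (by simp)
  have hA' : ∀ (i : Fin n) k, A i.castSucc (QSphereL2.e k) =
      ((q ^ qss i k * √(1 - q ^ (2 * (k.1 i + 1))) : ℝ) : ℂ) • QSphereL2.e (qsσ i k) := by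
    intro i k
    rw [hA, qss_Iio]
    rfl
  have hAl : ∀ k, A (Fin.last n) (QSphereL2.e k) =
      ((q ^ qss n k : ℝ) : ℂ) • QSphereL2.e (qsτ k) := by
    intro k
    rw [hA_last, qss_last]
    rfl
  have hZ' : ∀ (i : Fin n) k, Z i.castSucc (QSphereL2.e k) =
      ((qsw i k : ℝ) : ℂ) • QSphereL2.e (qsσ i k) := by
    intro i k
    rw [hZ]
    by_cases h : qsP i k
    · rw [if_pos ((qsP_Iio i k).2 h), qsw_pos h, Complex.ofReal_one, one_smul]
      rfl
    · rw [if_neg (fun h' => h ((qsP_Iio i k).1 h')), qsw_neg h, Complex.ofReal_zero, zero_smul]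
  have hZl : ∀ k, Z (Fin.last n) (QSphereL2.e k) =
      ((qsw n k : ℝ) : ℂ) • QSphereL2.e (qsτ k) := by
    intro k
    rw [hZ_last]
    by_cases h : qsP n k
    · rw [if_pos ((qsP_last k).2 h), qsw_pos h, Complex.ofReal_one, one_smul]
      rfl
    · rw [if_neg (fun h' => h ((qsP_last k).1 h')), qsw_neg h, Complex.ofReal_zero, zero_smul]
  apply le_antisymm
  · set C := (StarAlgebra.adjoin ℂ (Set.range Z)).topologicalClosure with hCdef
    have hC : IsClosed (C : Set (QSphereL2 n →L[ℂ] QSphereL2 n)) :=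
      StarSubalgebra.isClosed_topologicalClosure _
    have hZC : ∀ i, Z i ∈ C := fun i => StarSubalgebra.le_topologicalClosure _
      (StarAlgebra.subset_adjoin ℂ _ ⟨i, rfl⟩)
    refine StarSubalgebra.topologicalClosure_minimal (StarAlgebra.adjoin_le ?_) hC
    rintro _ ⟨i, rfl⟩
    change A i ∈ C
    induction i using Fin.lastCases with
    | last =>
      refine qs_descent C hC q hq0 hq1 (fun i => Z i.castSucc) (fun i => hZC _) hZ' n le_rfl
        (A (Fin.last n)) (Z (Fin.last n)) _ qsτ hAl (fun _ _ _ => rfl) (fun _ _ _ => rfl) ?_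
        (hZC _) ?_
      · intro k m hm
        rw [qss_σ_lt n m hm, pow_succ']
      · intro k
        rw [hZl]
        congr 2
        by_cases h : qsP n k
        · simp [(qss_zero_iff n k).2 h]
        · simp [qsw_neg h]
    | cast i =>
      obtain ⟨E, hE, hEe⟩ := qs_Z_E C hC q hq0 hq1 (fun i => Z i.castSucc) (fun i => hZC _) hZ' i
      obtain ⟨G, hG, hGe⟩ := qs_fc' C hC E hE _ (fun k => by
        by_cases h : qsP i k
        · rw [qsw_pos h, one_mul]
          exact ⟨by positivity, pow_le_one₀ hq0.le hq1.le⟩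
        · simp [qsw_neg h]) hEe (fun x => √(1 - q ^ 2 * x)) (by fun_prop)
      refine qs_descent C hC q hq0 hq1 (fun i => Z i.castSucc) (fun i => hZC _) hZ' i i.2.le
        (A i.castSucc) (Z i.castSucc * G) _ (qsσ i) (hA' i) ?_ ?_ ?_ (mul_mem (hZC _) hG) ?_
      · intro k m hm
        exact qsσ_ne (by rintro rfl; omega) k
      · intro k m hm
        have hmi : m ≠ i := by rintro rfl; omega
        simp only [qsσ, Prod.mk.injEq, and_true]
        rw [Function.update_of_ne hmi, Function.update_of_ne hmi.symm,
          Function.update_comm hmi.symm]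
      · intro k m hm
        have hmi : i ≠ m := by rintro rfl; omega
        rw [qss_σ_lt i m hm, qsσ_ne hmi, pow_succ', mul_assoc]
      · intro k
        rw [mul_apply_eq_comp, hGe, map_smul, hZ', smul_smul, ← Complex.ofReal_mul]
        congr 2
        by_cases h : qsP i k
        · rw [qsw_pos h, (qss_zero_iff i k).2 h, one_mul, one_mul, pow_zero, one_mul, mul_one,
            ← pow_add]
          congr 3
          ring
        · simp [qsw_neg h]
  · set C := (StarAlgebra.adjoin ℂ (Set.range A)).topologicalClosure with hCdef
    have hC : IsClosed (C : Set (QSphereL2 n →L[ℂ] QSphereL2 n)) :=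
      StarSubalgebra.isClosed_topologicalClosure _
    have hAC : ∀ i, A i ∈ C := fun i => StarSubalgebra.le_topologicalClosure _
      (StarAlgebra.subset_adjoin ℂ _ ⟨i, rfl⟩)
    refine StarSubalgebra.topologicalClosure_minimal (StarAlgebra.adjoin_le ?_) hC
    rintro _ ⟨i, rfl⟩
    change Z i ∈ C
    have hQ := qs_A_Q C hC q hq0 hq1 (fun i => A i.castSucc) (fun i => hAC _) hA'
    induction i using Fin.lastCases with
    | last =>
      obtain ⟨Q, hQC, hQe⟩ := hQ n le_rfl
      rw [qs_ext (S := Z (Fin.last n)) (T := A (Fin.last n) * Q) fun k => ?_]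
      · exact mul_mem (hAC _) hQC
      · rw [hZl, mul_apply_eq_comp, hQe, map_smul, hAl, smul_smul, ← Complex.ofReal_mul]
        congr 2
        by_cases h : qsP n k
        · simp [(qss_zero_iff n k).2 h]
        · simp [qsw_neg h]
    | cast i =>
      obtain ⟨Q, hQC, hQe⟩ := hQ i i.2.le
      obtain ⟨D, hD, hDe⟩ := qs_A_D C q hq0 hq1 (fun i => A i.castSucc) (fun i => hAC _) hA'
        (i + 1) i.2
      obtain ⟨G, hG, hGe⟩ := qs_fc' C hC D hD (fun k => q ^ (2 * qss (i + 1) k))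
        (fun k => ⟨by positivity, pow_le_one₀ hq0.le hq1.le⟩) hDe
        (fun x => (√(1 - q ^ 2 * x))⁻¹) (by
          refine ContinuousOn.inv₀ (by fun_prop) ?_
          intro x hx
          refine (Real.sqrt_pos.2 ?_).ne'
          nlinarith [hx.1, hx.2, sq_nonneg q])
      rw [qs_ext (S := Z i.castSucc) (T := A i.castSucc * Q * G) fun k => ?_]
      · exact mul_mem (mul_mem (hAC _) hQC) hG
      · rw [hZ', mul_apply_eq_comp, mul_apply_eq_comp, hGe, map_smul, hQe, map_smul, map_smul,
          hA', smul_smul, smul_smul, ← Complex.ofReal_mul, ← Complex.ofReal_mul]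
        congr 2
        by_cases h : qsP i k
        · rw [qsw_pos h, qss_succ, (qss_zero_iff i k).2 h, zero_add, pow_zero, one_mul, mul_one,
            ← pow_add, show 2 + 2 * k.1 i = 2 * (k.1 i + 1) by ring]
          refine (inv_mul_cancel₀ (Real.sqrt_pos.2 ?_).ne').symm
          rw [sub_pos]
          exact pow_lt_one₀ hq0.le hq1 (by omega)
        · simp [qsw_neg h]
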